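/- Attack-free residue bound: If a ≡ 0 (equivalently I = [p]), then the residue of the real-valued observer satisfies ‖r̂(t)‖ ≤ 2κ·z̃_ini·1_{t<l_max} for all t ≥ 0. -/

import Mathlib

open Matrix

/-- Infinity norm of a finite-dimensional real vector. -/
noncomputable def vnorm {ι : Type*} (v : ι → ℝ) : ℝ := sSup (Set.range fun i => |v i|)

/-- Operator norm of a real matrix induced by the infinity-norm on vectors. -/
noncomputable def mnorm {ι κ : Type*} [Fintype κ] (A : Matrix ι κ ℝ) : ℝ :=
  sSup (Set.range fun i => ∑ j, |A i j|)

/-- The `d × d` lower-shift matrix `F̄ᵢ` (ones on the first subdiagonal). -/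
def shiftM (d : ℕ) : Matrix (Fin d) (Fin d) ℝ :=
  Matrix.of fun r c => if (r : ℕ) = (c : ℕ) + 1 then (1 : ℝ) else 0

/-- The observable-canonical-form state matrix `Fᵢ`. -/
def canonF {d : ℕ} (f : Fin d → ℝ) : Matrix (Fin d) (Fin d) ℝ :=
  Matrix.of fun r c =>
    (if (r : ℕ) = (c : ℕ) + 1 then (1 : ℝ) else 0) + (if (c : ℕ) = d - 1 then f r else 0)

theorem abs_le_vnorm {ι : Type*} [Finite ι] (v : ι → ℝ) (i : ι) : |v i| ≤ vnorm v :=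
  le_csSup (Set.finite_range _).bddAbove ⟨i, rfl⟩

theorem vnorm_nonneg {ι : Type*} (v : ι → ℝ) : 0 ≤ vnorm v :=
  Real.sSup_nonneg (by rintro _ ⟨i, rfl⟩; exact abs_nonneg _)

theorem vnorm_le {ι : Type*} {v : ι → ℝ} {b : ℝ} (hb : 0 ≤ b) (h : ∀ i, |v i| ≤ b) :
    vnorm v ≤ b :=
  Real.sSup_le (by rintro _ ⟨i, rfl⟩; exact h i) hb

theorem mnorm_nonneg {ι κ : Type*} [Fintype κ] (A : Matrix ι κ ℝ) : 0 ≤ mnorm A :=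
  Real.sSup_nonneg (by rintro _ ⟨i, rfl⟩; exact Finset.sum_nonneg fun _ _ => abs_nonneg _)

theorem abs_mulVec_le {ι κ : Type*} [Finite ι] [Fintype κ] (A : Matrix ι κ ℝ) {v : κ → ℝ}
    {b : ℝ} (hb : 0 ≤ b) (hv : ∀ j, |v j| ≤ b) (i : ι) : |A.mulVec v i| ≤ mnorm A * b :=
  calc |A.mulVec v i| ≤ ∑ j, |A i j * v j| := Finset.abs_sum_le_sum_abs _ _
    _ ≤ ∑ j, |A i j| * b := Finset.sum_le_sum fun j _ => by
        rw [abs_mul]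
        exact mul_le_mul_of_nonneg_left (hv j) (abs_nonneg _)
    _ = (∑ j, |A i j|) * b := (Finset.sum_mul ..).symm
    _ ≤ mnorm A * b :=
        mul_le_mul_of_nonneg_right (le_csSup (Set.finite_range _).bddAbove ⟨i, rfl⟩) hb

theorem mulVec_eq_sub_of_leftInverse {ι κ : Type*} [Fintype ι] [DecidableEq ι] [Fintype κ]
    {L : Matrix ι κ ℝ} {M : Matrix κ ι ℝ} (h : L * M = 1) (x : ι → ℝ) (z : κ → ℝ) :
    L.mulVec z = x - L.mulVec (M.mulVec x - z) := by
  rw [mulVec_sub, mulVec_mulVec, h, one_mulVec, sub_sub_cancel]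

theorem shiftM_mulVec_of_succ {d : ℕ} (v : Fin d → ℝ) (j : ℕ) (hj : j + 1 < d) :
    (shiftM d).mulVec v ⟨j + 1, hj⟩ = v ⟨j, by omega⟩ := by
  rw [mulVec, dotProduct, Finset.sum_eq_single (⟨j, by omega⟩ : Fin d)]
  · simp [shiftM]
  · intro c _ hc
    have : j ≠ (c : ℕ) := fun h => hc (Fin.ext h.symm)
    simp [shiftM, this]
  · simp

theorem shiftM_mulVec_zero {d : ℕ} (v : Fin d → ℝ) (hd : 0 < d) :
    (shiftM d).mulVec v ⟨0, hd⟩ = 0 := by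
  simp [mulVec, dotProduct, shiftM]

theorem canonF_mulVec {d : ℕ} (hd : 0 < d) (f v : Fin d → ℝ) :
    (canonF f).mulVec v =
      (shiftM d).mulVec v + v ⟨d - 1, Nat.sub_lt hd Nat.one_pos⟩ • f := by
  funext r
  simp only [mulVec, dotProduct, canonF, shiftM, of_apply, add_mul, Finset.sum_add_distrib,
    Pi.add_apply, Pi.smul_apply, smul_eq_mul]
  congr 1
  rw [Finset.sum_eq_single (⟨d - 1, Nat.sub_lt hd Nat.one_pos⟩ : Fin d)]
  · simp [mul_comm]
  · intro c _ hc
    have : (c : ℕ) ≠ d - 1 := fun h => hc (Fin.ext h)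
    simp [this]
  · simp

/-- A sequence driven by the lower shift stays below its initial bound and its first `t` entries
vanish at time `t`. -/
theorem abs_le_of_shiftM_iterate {d : ℕ} {e : ℕ → Fin d → ℝ}
    (he : ∀ t, e (t + 1) = (shiftM d).mulVec (e t)) {b : ℝ} (h0 : ∀ j, |e 0 j| ≤ b)
    (t : ℕ) (j : Fin d) : |e t j| ≤ if t ≤ (j : ℕ) then b else 0 := by
  induction t generalizing j with
  | zero => simpa using h0 j
  | succ t ih =>
    rw [he]
    obtain ⟨j, hj⟩ := j
    cases j with
    | zero => simp [shiftM_mulVec_zero]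
    | succ j =>
      rw [shiftM_mulVec_of_succ]
      simpa using ih ⟨j, by omega⟩

/-- Attack-free residue bound: if `a ≡ 0` (i.e. `I = [p]`), then the residue
`r̂(t) = (x̂_Λ(t) − x̂(t))_{Λ ∈ P}` of the real-valued observer satisfies
`‖r̂(t)‖ ≤ 2 κ z̃_ini 1_{t < l_max}` for all `t ≥ 0`.  The stacked residue is indexed by
pairs `(Λ, i)` with `Λ ∈ P = {Λ ⊆ [p] : |Λ| = p − k}` and `i ∈ [n]`, and its infinity
norm is the supremum of the absolute values of its entries. -/
theorem stmt2 (n m p k : ℕ) (hk : k < p)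
    (A : Matrix (Fin n) (Fin n) ℝ) (B : Matrix (Fin n) (Fin m) ℝ)
    (C : Matrix (Fin p) (Fin n) ℝ)
    (x : ℕ → Fin n → ℝ) (u : ℕ → Fin m → ℝ) (y a : ℕ → Fin p → ℝ)
    (hx : ∀ t, x (t + 1) = A.mulVec (x t) + B.mulVec (u t))
    (hy : ∀ t, y t = C.mulVec (x t) + a t)
    (li : Fin p → ℕ) (hli : ∀ i, 0 < li i)
    (Φ : (i : Fin p) → Matrix (Fin (li i)) (Fin n) ℝ)
    (hΦrow : ∀ i, LinearIndependent ℝ (fun r : Fin (li i) => Φ i r))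
    (fc : (i : Fin p) → Fin (li i) → ℝ)
    (hΦA : ∀ i, Φ i * A = canonF (fc i) * Φ i)
    (hC : ∀ i, C i = Φ i ⟨li i - 1, Nat.sub_lt (hli i) Nat.one_pos⟩)
    (zh : (i : Fin p) → ℕ → Fin (li i) → ℝ)
    (hobs : ∀ i t, zh i (t + 1) =
      (shiftM (li i)).mulVec (zh i t) + (Φ i * B).mulVec (u t) + y t i • fc i)
    -- Assumption 2 (k-redundant observability)
    (hobsv : ∀ Λ : Finset (Fin p), p - k ≤ Λ.card → ∀ v : Fin n → ℝ,
      (∀ h : ℕ, ∀ i ∈ Λ, (C * A ^ h).mulVec v i = 0) → v = 0)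
    -- fixed left inverses Φ† and Φ_Λ†
    (Φdag : Matrix (Fin n) (Σ i : Fin p, Fin (li i)) ℝ)
    (hΦdag : Φdag * Matrix.of (fun (j : Σ i : Fin p, Fin (li i)) c => Φ j.1 j.2 c) = 1)
    (ΦdagΛ : (Λ : Finset (Fin p)) → Matrix (Fin n) {j : Σ i : Fin p, Fin (li i) // j.1 ∈ Λ} ℝ)
    (hΦdagΛ : ∀ Λ : Finset (Fin p), Λ.card = p - k →
      ΦdagΛ Λ * Matrix.of
        (fun (j : {j : Σ i : Fin p, Fin (li i) // j.1 ∈ Λ}) c => Φ j.1.1 j.1.2 c) = 1)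
    (κ : ℝ)
    (hκ : κ = max (mnorm Φdag)
      (sSup {r : ℝ | ∃ Λ : Finset (Fin p), Λ.card = p - k ∧ r = mnorm (ΦdagΛ Λ)}))
    (lmax : ℕ) (hlmax : lmax = Finset.univ.sup li)
    (ztil : ℝ)
    (hztil : ztil = sSup (Set.range fun i : Fin p =>
      vnorm (fun j => (Φ i).mulVec (x 0) j - zh i 0 j)))
    -- no attack
    (ha : ∀ t i, a t i = 0) :
    ∀ t, vnorm (fun ji : {Λ : Finset (Fin p) // Λ.card = p - k} × Fin n =>
        (ΦdagΛ ji.1.1).mulVec (fun jj => zh jj.1.1 t jj.1.2) ji.2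
          - Φdag.mulVec (fun jj => zh jj.1 t jj.2) ji.2) ≤
      2 * κ * ztil * (if t < lmax then 1 else 0) := by
  set e : (i : Fin p) → ℕ → Fin (li i) → ℝ := fun i t => (Φ i).mulVec (x t) - zh i t with he
  have hstep (i : Fin p) (t : ℕ) : e i (t + 1) = (shiftM (li i)).mulVec (e i t) := by
    have hyi : y t i = (Φ i).mulVec (x t) ⟨li i - 1, Nat.sub_lt (hli i) Nat.one_pos⟩ := by
      simp [hy, ha, mulVec, hC]
    simp only [he, hx, hobs, mulVec_add, mulVec_sub, mulVec_mulVec, hΦA, hyi]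
    rw [← mulVec_mulVec, canonF_mulVec (hli i), ← mulVec_mulVec, ← mulVec_mulVec]
    abel
  have hztil0 : 0 ≤ ztil := by
    rw [hztil]
    exact Real.sSup_nonneg (by rintro _ ⟨i, rfl⟩; exact vnorm_nonneg _)
  have hztil_bound (i : Fin p) (j : Fin (li i)) : |e i 0 j| ≤ ztil := by
    rw [hztil]
    exact (abs_le_vnorm (fun j => (Φ i).mulVec (x 0) j - zh i 0 j) j).trans
      (le_csSup (Set.finite_range _).bddAbove ⟨i, rfl⟩)
  intro t
  set b : ℝ := ztil * (if t < lmax then 1 else 0) with hb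
  have hb0 : 0 ≤ b := by positivity
  have hbound (i : Fin p) (j : Fin (li i)) : |e i t j| ≤ b := by
    refine (abs_le_of_shiftM_iterate (hstep i) (hztil_bound i) t j).trans ?_
    split_ifs with htj
    · have hle : li i ≤ lmax := hlmax ▸ Finset.le_sup (Finset.mem_univ i)
      have hlt : t < lmax := by omega
      simp [hb, hlt]
    · exact hb0
  have hκΦ : mnorm Φdag ≤ κ := hκ ▸ le_max_left _ _
  have hκ0 : 0 ≤ κ := (mnorm_nonneg _).trans hκΦ
  have hκΛ (Λ : Finset (Fin p)) (hΛ : Λ.card = p - k) : mnorm (ΦdagΛ Λ) ≤ κ := by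
    rw [hκ]
    refine le_max_of_le_right (le_csSup (Set.Finite.bddAbove ?_) ⟨Λ, hΛ, rfl⟩)
    refine (Set.finite_range fun Λ => mnorm (ΦdagΛ Λ)).subset ?_
    rintro _ ⟨Λ', -, rfl⟩
    exact ⟨Λ', rfl⟩
  rw [mul_assoc, ← hb]
  refine vnorm_le (by positivity) ?_
  rintro ⟨⟨Λ, hΛ⟩, i⟩
  have hfull := abs_mulVec_le Φdag hb0 (v := fun jj => e jj.1 t jj.2) (fun jj => hbound _ _) i
  have hsub := abs_mulVec_le (ΦdagΛ Λ) hb0 (v := fun jj => e jj.1.1 t jj.1.2)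
    (fun jj => hbound _ _) i
  have hfull' := hfull.trans (mul_le_mul_of_nonneg_right hκΦ hb0)
  have hsub' := hsub.trans (mul_le_mul_of_nonneg_right (hκΛ Λ hΛ) hb0)
  have hest := congrFun (mulVec_eq_sub_of_leftInverse hΦdag (x t) fun jj => zh jj.1 t jj.2) i
  have hestΛ := congrFun
    (mulVec_eq_sub_of_leftInverse (hΦdagΛ Λ hΛ) (x t) fun jj => zh jj.1.1 t jj.1.2) i
  change _ = x t i - Φdag.mulVec (fun jj => e jj.1 t jj.2) i at hest
  change _ = x t i - (ΦdagΛ Λ).mulVec (fun jj => e jj.1.1 t jj.1.2) i at hestΛ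
  dsimp only
  rw [hest, hestΛ, sub_sub_sub_cancel_left]
  refine (abs_sub _ _).trans ?_
  linarith
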